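/- Let f, C_I, E, g_y, D be as in the standard setup and assume D(t) > 0 on I. Equip ℝ² with the Lie bracket [u,v] = (u¹v² − u²v¹)·(0, 1) (i.e. [e₁,e₂] = e₂), and let η : C_I → ℝ² be the spray vector field, characterized by g_y(η(y), u) = g_y(y, [u, y]) for all u ∈ ℝ². Then along the indicatrix curve y(t) = (2f(t))^{−1/2}·(cos t, sin t) one has η(y(t)) = [√(2f(t))·(−2f(t)·sin t − f'(t)·cos t)/D(t)] · y'(t) for every t ∈ I. -/

import Mathlib

open Real Set

/-- The Hessian bilinear form (fundamental form) of the energy function `E` at `y`. -/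
noncomputable def hessian (E : ℝ × ℝ → ℝ) (y u v : ℝ × ℝ) : ℝ :=
  fderiv ℝ (fderiv ℝ E) y u v

/-- The energy function `E(y¹,y²) = ((y¹)² + (y²)²)·f(arctan(y²/y¹))`. -/
noncomputable def energy (f : ℝ → ℝ) (y : ℝ × ℝ) : ℝ :=
  (y.1 ^ 2 + y.2 ^ 2) * f (Real.arctan (y.2 / y.1))

/-- The open cone `C_I = {(y¹,y²) : y¹ > 0, arctan(y²/y¹) ∈ I}`. -/
def cone (I : Set ℝ) : Set (ℝ × ℝ) :=
  {y : ℝ × ℝ | 0 < y.1 ∧ Real.arctan (y.2 / y.1) ∈ I}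

/-- `D(t) = 2f(t)f''(t) − f'(t)² + 4f(t)²`. -/
noncomputable def Dfun (f : ℝ → ℝ) (t : ℝ) : ℝ :=
  2 * f t * deriv (deriv f) t - (deriv f t) ^ 2 + 4 * (f t) ^ 2

/-- The Lie bracket with `[e₁,e₂] = e₂`. -/
def bracket' (u v : ℝ × ℝ) : ℝ × ℝ :=
  (u.1 * v.2 - u.2 * v.1) • (((0 : ℝ), (1 : ℝ)) : ℝ × ℝ)

/-- The indicatrix curve `y(t) = (2f(t))^{−1/2}·(cos t, sin t)`. -/
noncomputable def indicatrix (f : ℝ → ℝ) (t : ℝ) : ℝ × ℝ :=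
  (1 / Real.sqrt (2 * f t)) • ((Real.cos t, Real.sin t) : ℝ × ℝ)

lemma theta_hasFDerivAt (p : ℝ × ℝ) (hp : 0 < p.1) :
    HasFDerivAt (fun q : ℝ × ℝ => Real.arctan (q.2 / q.1))
      ((-p.2 / (p.1 ^ 2 + p.2 ^ 2)) • ContinuousLinearMap.fst ℝ ℝ ℝ +
        (p.1 / (p.1 ^ 2 + p.2 ^ 2)) • ContinuousLinearMap.snd ℝ ℝ ℝ) p := by
  have h1 : HasFDerivAt (fun q : ℝ × ℝ => q.1) (ContinuousLinearMap.fst ℝ ℝ ℝ) p := hasFDerivAt_fst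
  have h2 : HasFDerivAt (fun q : ℝ × ℝ => q.2) (ContinuousLinearMap.snd ℝ ℝ ℝ) p := hasFDerivAt_snd
  have h3 := ((h2.mul ((hasDerivAt_inv hp.ne').comp_hasFDerivAt p h1))).arctan
  have hr : 0 < p.1 ^ 2 + p.2 ^ 2 := by positivity
  have h4 : 0 < 1 + (p.2 * p.1⁻¹) ^ 2 := by positivity
  have h5 : (fun q : ℝ × ℝ => Real.arctan (q.2 / q.1)) =
      fun q : ℝ × ℝ => Real.arctan (q.2 * (Inv.inv ∘ fun q : ℝ × ℝ => q.1) q) := by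
    funext q; simp [div_eq_mul_inv]
  rw [h5]
  refine h3.congr_fderiv ?_
  have hx := hp.ne'
  have h6 : 1 + (p.2 * p.1⁻¹) ^ 2 = (p.1 ^ 2 + p.2 ^ 2) / p.1 ^ 2 := by field_simp
  apply ContinuousLinearMap.ext
  intro v
  simp [h6]
  field_simp

lemma cone_isOpen (I : Set ℝ) (hI : IsOpen I) : IsOpen (cone I) := by
  rw [isOpen_iff_mem_nhds]
  intro p hp
  have h1 : ∀ᶠ q : ℝ × ℝ in nhds p, 0 < q.1 := continuous_fst.continuousAt.eventually (lt_mem_nhds hp.1)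
  have h2 : ∀ᶠ q : ℝ × ℝ in nhds p, Real.arctan (q.2 / q.1) ∈ I :=
    (theta_hasFDerivAt p hp.1).continuousAt.eventually (hI.mem_nhds hp.2)
  filter_upwards [h1, h2] with q a b using ⟨a, b⟩

lemma energy_hasFDerivAt (f : ℝ → ℝ) (p : ℝ × ℝ) (hp : 0 < p.1)
    (hf : DifferentiableAt ℝ f (Real.arctan (p.2 / p.1))) :
    HasFDerivAt (energy f)
      ((2 * p.1 * f (Real.arctan (p.2 / p.1)) - p.2 * deriv f (Real.arctan (p.2 / p.1))) •
          ContinuousLinearMap.fst ℝ ℝ ℝ +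
        (2 * p.2 * f (Real.arctan (p.2 / p.1)) + p.1 * deriv f (Real.arctan (p.2 / p.1))) •
          ContinuousLinearMap.snd ℝ ℝ ℝ) p := by
  have h1 : HasFDerivAt (fun q : ℝ × ℝ => q.1) (ContinuousLinearMap.fst ℝ ℝ ℝ) p := hasFDerivAt_fst
  have h2 : HasFDerivAt (fun q : ℝ × ℝ => q.2) (ContinuousLinearMap.snd ℝ ℝ ℝ) p := hasFDerivAt_snd
  have h3 := hf.hasDerivAt.comp_hasFDerivAt p (theta_hasFDerivAt p hp)
  have h4 := ((h1.pow 2).add (h2.pow 2)).mul h3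
  have hr : 0 < p.1 ^ 2 + p.2 ^ 2 := by positivity
  refine HasFDerivAt.congr_fderiv (f := energy f) h4 ?_
  apply ContinuousLinearMap.ext
  intro v
  simp
  field_simp
  ring

lemma hessian_energy (I : Set ℝ) (hI : IsOpen I) (f : ℝ → ℝ) (hf : ContDiffOn ℝ (⊤ : ℕ∞) f I)
    (p : ℝ × ℝ) (hp : p ∈ cone I) (t : ℝ) (ht : Real.arctan (p.2 / p.1) = t) (u v : ℝ × ℝ) :
    hessian (energy f) p u v * (p.1 ^ 2 + p.2 ^ 2) =
      (2 * f t * (p.1 ^ 2 + p.2 ^ 2) - 2 * p.1 * p.2 * deriv f t + p.2 ^ 2 * deriv (deriv f) t)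
          * (u.1 * v.1)
      + ((p.1 ^ 2 - p.2 ^ 2) * deriv f t - p.1 * p.2 * deriv (deriv f) t)
          * (u.1 * v.2 + u.2 * v.1)
      + (2 * f t * (p.1 ^ 2 + p.2 ^ 2) + 2 * p.1 * p.2 * deriv f t + p.1 ^ 2 * deriv (deriv f) t)
          * (u.2 * v.2) := by
  have hfd : ∀ s ∈ I, DifferentiableAt ℝ f s := fun s hs =>
    (hf.contDiffAt (hI.mem_nhds hs)).differentiableAt (by simp)
  have hfd2 : DifferentiableAt ℝ (deriv f) (Real.arctan (p.2 / p.1)) := by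
    have := (hf.deriv_of_isOpen (m := 1) hI (by norm_cast))
    exact (this.contDiffAt (hI.mem_nhds hp.2)).differentiableAt (by simp)
  have hE : fderiv ℝ (energy f) =ᶠ[nhds p] fun p =>
      ((2 * p.1 * f (Real.arctan (p.2 / p.1)) - p.2 * deriv f (Real.arctan (p.2 / p.1))) •
          ContinuousLinearMap.fst ℝ ℝ ℝ +
        (2 * p.2 * f (Real.arctan (p.2 / p.1)) + p.1 * deriv f (Real.arctan (p.2 / p.1))) •
          ContinuousLinearMap.snd ℝ ℝ ℝ) := by
    filter_upwards [(cone_isOpen I hI).mem_nhds hp] with q hq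
    exact (energy_hasFDerivAt f q hq.1 (hfd _ hq.2)).fderiv
  have h1 : HasFDerivAt (fun q : ℝ × ℝ => q.1) (ContinuousLinearMap.fst ℝ ℝ ℝ) p := hasFDerivAt_fst
  have h2 : HasFDerivAt (fun q : ℝ × ℝ => q.2) (ContinuousLinearMap.snd ℝ ℝ ℝ) p := hasFDerivAt_snd
  have h3 := (hfd _ hp.2).hasDerivAt.comp_hasFDerivAt p (theta_hasFDerivAt p hp.1)
  have h4 := hfd2.hasDerivAt.comp_hasFDerivAt p (theta_hasFDerivAt p hp.1)
  have hA := ((((h1.const_mul 2).mul h3).sub (h2.mul h4)).smul_const (ContinuousLinearMap.fst ℝ ℝ ℝ)).add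
    ((((h2.const_mul 2).mul h3).add (h1.mul h4)).smul_const (ContinuousLinearMap.snd ℝ ℝ ℝ))
  have hp1 := hp.1
  have hr : 0 < p.1 ^ 2 + p.2 ^ 2 := by positivity
  have hB := (hA.congr_of_eventuallyEq hE).fderiv
  unfold hessian
  rw [hB]
  simp [ht]
  field_simp
  ring

theorem spray_along_indicatrix
    (I : Set ℝ) (hIopen : IsOpen I) (hIsub : I ⊆ Ioo (-(π / 2)) (π / 2))
    (hI0 : (0 : ℝ) ∈ I)
    (f : ℝ → ℝ) (hf : ContDiffOn ℝ (⊤ : ℕ∞) f I) (hfpos : ∀ t ∈ I, 0 < f t)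
    (hD : ∀ t ∈ I, 0 < Dfun f t)
    (η : ℝ × ℝ → ℝ × ℝ)
    (hη : ∀ y ∈ cone I, ∀ u : ℝ × ℝ,
      hessian (energy f) y (η y) u = hessian (energy f) y y (bracket' u y)) :
    ∀ t ∈ I,
      η (indicatrix f t) =
        (Real.sqrt (2 * f t) * (-2 * f t * Real.sin t - deriv f t * Real.cos t) / Dfun f t) •
          deriv (indicatrix f) t := by
  intro t ht
  have hft := hfpos t ht
  have hDt := hD t ht
  have hc : 0 < Real.cos t := Real.cos_pos_of_mem_Ioo (hIsub ht)
  have hcs := Real.sin_sq_add_cos_sq t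
  obtain ⟨R, hR⟩ : ∃ R, R = Real.sqrt (2 * f t) := ⟨_, rfl⟩
  have hRpos : 0 < R := by rw [hR]; positivity
  have hR2 : R ^ 2 = 2 * f t := by rw [hR]; exact Real.sq_sqrt (by positivity)
  have hfd : HasDerivAt f (deriv f t) t :=
    ((hf.contDiffAt (hIopen.mem_nhds ht)).differentiableAt (by simp)).hasDerivAt
  have hy1 : (indicatrix f t).1 = Real.cos t / R := by
    simp [indicatrix, hR]; ring
  have hy2 : (indicatrix f t).2 = Real.sin t / R := by
    simp [indicatrix, hR]; ring
  have harc : Real.arctan ((indicatrix f t).2 / (indicatrix f t).1) = t := by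
    rw [hy1, hy2, div_div_div_cancel_right₀ hRpos.ne', ← Real.tan_eq_sin_div_cos]
    exact Real.arctan_tan (hIsub ht).1 (hIsub ht).2
  have hcone : indicatrix f t ∈ cone I := by
    refine ⟨?_, ?_⟩
    · rw [hy1]; positivity
    · rw [harc]; exact ht
  have hinv : HasDerivAt (fun s => 1 / Real.sqrt (2 * f s)) (-deriv f t / R ^ 3) t := by
    have h := ((hfd.const_mul 2).sqrt (by positivity)).inv (by rw [← hR]; exact hRpos.ne')
    have e : (fun s => 1 / Real.sqrt (2 * f s)) = (fun s => Real.sqrt (2 * f s))⁻¹ := by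
      funext s; simp
    rw [e]
    refine h.congr_deriv ?_
    rw [← hR]
    field_simp
  have hder : deriv (indicatrix f) t =
      (-deriv f t / R ^ 3 * Real.cos t - Real.sin t / R,
        -deriv f t / R ^ 3 * Real.sin t + Real.cos t / R) := by
    have h := (hinv.mul (Real.hasDerivAt_cos t)).prodMk (hinv.mul (Real.hasDerivAt_sin t))
    have e : indicatrix f = fun s => (((fun s => 1 / Real.sqrt (2 * f s)) * Real.cos) s,
        ((fun s => 1 / Real.sqrt (2 * f s)) * Real.sin) s) := by
      funext s; simp [indicatrix]
    rw [e, h.deriv, ← hR]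
    ext <;> simp <;> ring
  have hr : (indicatrix f t).1 ^ 2 + (indicatrix f t).2 ^ 2 = 1 / R ^ 2 := by
    rw [hy1, hy2]; field_simp; linarith
  have hH : ∀ u v : ℝ × ℝ, hessian (energy f) (indicatrix f t) u v =
      (2 * f t - 2 * Real.cos t * Real.sin t * deriv f t
        + Real.sin t ^ 2 * deriv (deriv f) t) * (u.1 * v.1)
      + ((Real.cos t ^ 2 - Real.sin t ^ 2) * deriv f t
        - Real.cos t * Real.sin t * deriv (deriv f) t) * (u.1 * v.2 + u.2 * v.1)
      + (2 * f t + 2 * Real.cos t * Real.sin t * deriv f t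
        + Real.cos t ^ 2 * deriv (deriv f) t) * (u.2 * v.2) := by
    intro u v
    have h := hessian_energy I hIopen f hf _ hcone t harc u v
    rw [hr, hy1, hy2] at h
    field_simp at h
    linear_combination h
  have k1 := hη _ hcone (Real.cos t, Real.sin t)
  have k2 := hη _ hcone (-Real.sin t, Real.cos t)
  simp only [hH, bracket', hy1, hy2, Prod.smul_mk, smul_eq_mul, mul_zero, mul_one] at k1 k2
  rw [hder, ← hR]
  unfold Dfun at hDt ⊢
  generalize η (indicatrix f t) = w at *
  obtain ⟨a, b⟩ := w
  clear hη hH hder hinv hr hcone harc hy1 hy2 hfd hR hfpos hD hf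
  generalize Real.cos t = c at *
  generalize Real.sin t = s at *
  generalize deriv (deriv f) t = f2 at *
  generalize deriv f t = f1 at *
  generalize f t = f0 at *
  simp only at k1 k2
  have hRn := hRpos.ne'
  have q1 : 2 * f0 * (a * c + b * s) + f1 * (b * c - a * s) = 0 := by
    have e : (c * (s / R) - s * (c / R)) = 0 := by ring
    rw [e] at k1
    linear_combination k1 + (a * f1 * s - b * f1 * c) * hcs
  have q2 : (f1 * (a * c + b * s) + (2 * f0 + f2) * (b * c - a * s)) * R ^ 2 =
      -(2 * s * f0 + c * f1) := by
    have e : (-s * (s / R) - c * (c / R)) = -(1 / R) := by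
      field_simp; linear_combination -hcs
    rw [e] at k2
    field_simp at k2
    linear_combination k2 + (- R ^ 2 * (a * (c * f1 - s * f2) + b * (s * f1 + c * f2)) - c * f1) * hcs
  rw [hR2] at q2
  have hDn := hDt.ne'
  have q3 : (b * c - a * s) * (2 * f0 * f2 - f1 ^ 2 + 4 * f0 ^ 2) = -(2 * s * f0 + c * f1) := by
    linear_combination q2 - f1 * q1
  have q4 : (a * c + b * s) * (2 * f0 * f2 - f1 ^ 2 + 4 * f0 ^ 2) * R ^ 2 =
      f1 * (2 * s * f0 + c * f1) := by
    rw [hR2]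
    linear_combination (2 * f0 * f2 - f1 ^ 2 + 4 * f0 ^ 2) * q1 - f1 * q3
  have ha : a = c * (a * c + b * s) - s * (b * c - a * s) := by linear_combination -a * hcs
  have hb : b = s * (a * c + b * s) + c * (b * c - a * s) := by linear_combination -b * hcs
  generalize a * c + b * s = P at *
  generalize b * c - a * s = Q at *
  generalize 2 * f0 * f2 - f1 ^ 2 + 4 * f0 ^ 2 = D at *
  ext
  · simp only [Prod.smul_mk, smul_eq_mul]
    rw [ha]
    field_simp
    linear_combination c * q4 - s * R ^ 2 * q3
  · simp only [Prod.smul_mk, smul_eq_mul]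
    rw [hb]
    field_simp
    linear_combination s * q4 + c * R ^ 2 * q3
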